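/- arXiv:1802.05703 — 5 statements merged into one kernel-verified Lean document; each statement's English description precedes it below -/
import Mathlib

section
/- Let S be a countable ℵ₀-categorical semigroup. Then S has, up to semigroup isomorphism, only finitely many principal two-sided ideals S¹aS¹ (a ∈ S), and each principal two-sided ideal is ℵ₀-categorical; the same holds for principal left ideals S¹a and principal right ideals aS¹. -/
/-- Two `n`-tuples of a semigroup are automorphically equivalent if some semigroup
automorphism maps one to the other componentwise. -/
def AutRel (S : Type*) [Semigroup S] {n : ℕ} (a b : Fin n → S) : Prop :=
  ∃ φ : S ≃* S, ∀ k, φ (a k) = b k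

/-- A semigroup is ℵ₀-categorical if, for every `n ≥ 1`, the action of its automorphism
group on `n`-tuples has only finitely many orbits. -/
def Aleph0Categorical (S : Type*) [Semigroup S] : Prop :=
  ∀ n : ℕ, 1 ≤ n → ∃ t : Set (Fin n → S), t.Finite ∧
    ∀ a : Fin n → S, ∃ b ∈ t, AutRel S b a

/-- The principal right ideal `aS¹ = {a} ∪ aS`, as a subsemigroup. -/
def principalRight {S : Type*} [Semigroup S] (a : S) : Subsemigroup S where
  carrier := {a} ∪ {x | ∃ s, x = a * s}
  mul_mem' := by
    intro x y hx hy
    rcases hx with rfl | ⟨s, rfl⟩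
    · exact Or.inr ⟨y, rfl⟩
    · exact Or.inr ⟨s * y, by simp [mul_assoc]⟩

/-- The principal left ideal `S¹a = {a} ∪ Sa`, as a subsemigroup. -/
def principalLeft {S : Type*} [Semigroup S] (a : S) : Subsemigroup S where
  carrier := {a} ∪ {x | ∃ s, x = s * a}
  mul_mem' := by
    intro x y hx hy
    rcases hy with rfl | ⟨s, rfl⟩
    · exact Or.inr ⟨x, rfl⟩
    · exact Or.inr ⟨x * s, by simp [mul_assoc]⟩

/-- The principal two-sided ideal `S¹aS¹ = {a} ∪ aS ∪ Sa ∪ SaS`, as a subsemigroup. -/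
def principalTwoSided {S : Type*} [Semigroup S] (a : S) : Subsemigroup S where
  carrier := {a} ∪ {x | ∃ s, x = a * s} ∪ {x | ∃ s, x = s * a} ∪ {x | ∃ s u, x = s * a * u}
  mul_mem' := by
    intro x y hx hy
    rcases hy with ((rfl | ⟨s, rfl⟩) | ⟨s, rfl⟩) | ⟨s, u, rfl⟩
    · exact Or.inl (Or.inr ⟨x, rfl⟩)
    · exact Or.inr ⟨x, s, by simp [mul_assoc]⟩
    · exact Or.inl (Or.inr ⟨x * s, by simp [mul_assoc]⟩)
    · exact Or.inr ⟨x * s, u, by simp [mul_assoc]⟩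

/-- An automorphism carrying `a` to `b` restricts to an isomorphism of the attached
subsemigroups, for any automorphism-equivariant family. -/
def restrictIso {S : Type*} [Semigroup S] (P : S → Subsemigroup S)
    (hP : ∀ (φ : S ≃* S) (a x : S), x ∈ P a → φ x ∈ P (φ a))
    (φ : S ≃* S) (a b : S) (h : φ a = b) : P a ≃* P b where
  toFun x := ⟨φ x.1, h ▸ hP φ a x.1 x.2⟩
  invFun x := ⟨φ.symm x.1, by
    have h2 := hP φ.symm b x.1 x.2
    have h3 : φ.symm b = a := by rw [← h, MulEquiv.symm_apply_apply]
    rwa [h3] at h2⟩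
  left_inv x := by simp
  right_inv x := by simp
  map_mul' x y := by ext; simp

theorem equivariant_family {S : Type*} [Semigroup S] (hcat : Aleph0Categorical S)
    (P : S → Subsemigroup S)
    (hP : ∀ (φ : S ≃* S) (a x : S), x ∈ P a → φ x ∈ P (φ a)) :
    (∃ F : Set S, F.Finite ∧ ∀ a : S, ∃ b ∈ F, Nonempty (P a ≃* P b)) ∧
      ∀ a : S, Aleph0Categorical (P a) := by
  constructor
  · obtain ⟨t, ht, h⟩ := hcat 1 le_rfl
    refine ⟨Set.image (fun c => c 0) t, ht.image _, fun a => ?_⟩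
    obtain ⟨b, hb, φ, hφ⟩ := h (fun _ => a)
    exact ⟨b 0, ⟨b, hb, rfl⟩, ⟨(restrictIso P hP φ (b 0) a (hφ 0)).symm⟩⟩
  · intro a n _
    obtain ⟨t, ht, h⟩ := hcat (n + 1) (Nat.le_add_left 1 n)
    classical
    let tup : (Fin n → P a) → Fin (n + 1) → S := fun c => Fin.cons a (fun k => (c k : S))
    let R : Set (Fin (n + 1) → S) := {b | b ∈ t ∧ ∃ c : Fin n → P a, AutRel S b (tup c)}
    have hR : R.Finite := ht.subset fun b hb => hb.1
    have hch : ∀ b : R, ∃ c : Fin n → P a, AutRel S b.1 (tup c) := fun b => b.2.2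
    choose f hf using hch
    have : Finite R := hR
    refine ⟨Set.range f, Set.finite_range f, fun c => ?_⟩
    obtain ⟨b, hb, φ, hφ⟩ := h (tup c)
    let bR : R := ⟨b, hb, c, φ, hφ⟩
    obtain ⟨ψ, hψ⟩ := hf bR
    have key : ∀ k, (ψ.symm.trans φ) (tup (f bR) k) = tup c k := by
      intro k
      rw [← hψ k, MulEquiv.trans_apply, MulEquiv.symm_apply_apply, hφ k]
    have h0 : (ψ.symm.trans φ) a = a := key 0
    refine ⟨f bR, ⟨bR, rfl⟩, restrictIso P hP _ a a h0, fun k => ?_⟩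
    apply Subtype.ext
    exact key k.succ

/-- A countable ℵ₀-categorical semigroup has, up to isomorphism, only finitely many
principal two-sided (resp. left, right) ideals, and each of them is ℵ₀-categorical. -/
theorem aleph0Categorical_principal_ideals (S : Type*) [Semigroup S] [Countable S]
    (hcat : Aleph0Categorical S) :
    ((∃ F : Set S, F.Finite ∧
        ∀ a : S, ∃ b ∈ F, Nonempty ((principalTwoSided a) ≃* (principalTwoSided b))) ∧
      ∀ a : S, Aleph0Categorical (principalTwoSided a)) ∧
    ((∃ F : Set S, F.Finite ∧
        ∀ a : S, ∃ b ∈ F, Nonempty ((principalLeft a) ≃* (principalLeft b))) ∧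
      ∀ a : S, Aleph0Categorical (principalLeft a)) ∧
    ((∃ F : Set S, F.Finite ∧
        ∀ a : S, ∃ b ∈ F, Nonempty ((principalRight a) ≃* (principalRight b))) ∧
      ∀ a : S, Aleph0Categorical (principalRight a)) := by
  refine ⟨equivariant_family hcat principalTwoSided ?_, equivariant_family hcat principalLeft ?_,
    equivariant_family hcat principalRight ?_⟩
  · rintro φ a x (((rfl | ⟨s, rfl⟩) | ⟨s, rfl⟩) | ⟨s, u, rfl⟩)
    · exact Or.inl (Or.inl (Or.inl rfl))
    · exact Or.inl (Or.inl (Or.inr ⟨φ s, map_mul φ _ _⟩))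
    · exact Or.inl (Or.inr ⟨φ s, map_mul φ _ _⟩)
    · exact Or.inr ⟨φ s, φ u, by simp⟩
  · rintro φ a x (rfl | ⟨s, rfl⟩)
    · exact Or.inl rfl
    · exact Or.inr ⟨φ s, map_mul φ _ _⟩
  · rintro φ a x (rfl | ⟨s, rfl⟩)
    · exact Or.inl rfl
    · exact Or.inr ⟨φ s, map_mul φ _ _⟩
end

section
/- Let S be a countable ℵ₀-categorical semigroup and ρ a congruence on S. If ρ is preserved by every automorphism of S, or if ρ is generated (as a congruence) by a finite set of pairs of elements of S, then the quotient semigroup S/ρ is ℵ₀-categorical. -/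
/-- If all automorphisms fixing a finite tuple pointwise respect `ρ`, the quotient is
ℵ₀-categorical. -/
theorem aleph0_quot_aux (S : Type*) [Semigroup S]
    (hcat : Aleph0Categorical S) (ρ : Con S) (m : ℕ) (c : Fin m → S)
    (h : ∀ φ : S ≃* S, (∀ i, φ (c i) = c i) → ∀ a b : S, ρ a b → ρ (φ a) (φ b)) :
    Aleph0Categorical ρ.Quotient := by
  classical
  intro n hn
  obtain ⟨t, ht, hcov⟩ := hcat (n + m) (by omega)
  let P : (Fin (n + m) → S) → (Fin n → S) → Prop := fun b a => AutRel S b (Fin.append a c)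
  let f : (Fin (n + m) → S) → Set (Fin n → ρ.Quotient) := fun b =>
    if hb : ∃ a, P b a then {fun k => ((hb.choose k : S) : ρ.Quotient)} else ∅
  refine ⟨⋃ b ∈ t, f b, ht.biUnion fun b _ => ?_, fun q => ?_⟩
  · by_cases hb : ∃ a, P b a
    · simp only [f, dif_pos hb]
      exact Set.finite_singleton _
    · simp only [f, dif_neg hb]
      exact Set.finite_empty
  · have hq : ∀ k, ∃ x : S, (x : ρ.Quotient) = q k := fun k => Quotient.exists_rep (q k)
    choose a ha using hq
    obtain ⟨b, hbt, hba⟩ := hcov (Fin.append a c)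
    have hb : ∃ a, P b a := ⟨a, hba⟩
    refine ⟨fun k => ((hb.choose k : S) : ρ.Quotient), ?_, ?_⟩
    · refine Set.mem_biUnion hbt ?_
      simp only [f, dif_pos hb]
      exact Set.mem_singleton _
    · obtain ⟨φ, hφ⟩ := hba
      obtain ⟨ψ, hψ⟩ := hb.choose_spec
      generalize hb.choose = a' at hψ
      have key : ∀ k, (ψ.symm.trans φ) (Fin.append a' c k) = Fin.append a c k := by
        intro k
        rw [← hψ k, ← hφ k]
        simp
      have hc : ∀ i, (ψ.symm.trans φ) (c i) = c i := by
        intro i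
        simpa only [Fin.append_right] using key (Fin.natAdd n i)
      have hA : ∀ i, (ψ.symm.trans φ) (a' i) = a i := by
        intro i
        simpa only [Fin.append_left] using key (Fin.castAdd m i)
      generalize ψ.symm.trans φ = θ at hc hA
      have hc' : ∀ i, θ.symm (c i) = c i := fun i => by
        rw [MulEquiv.symm_apply_eq, hc]
      refine ⟨Con.congr θ (c := ρ) (d := ρ) ?_, fun k => ?_⟩
      · ext x y
        constructor
        · intro hxy
          have := h θ hc _ _ hxy
          simpa using this
        · intro hxy
          have := h θ.symm hc' _ _ hxy
          simpa using this
      · rw [← ha k, ← hA k]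
        rfl

/-- Let `S` be a countable ℵ₀-categorical semigroup and `ρ` a congruence on `S`.  If `ρ`
is preserved by every automorphism of `S`, or `ρ` is generated as a congruence by a
finite set of pairs, then `S/ρ` is ℵ₀-categorical. -/
theorem aleph0Categorical_quotient_preserved_or_fg (S : Type*) [Semigroup S] [Countable S]
    (hcat : Aleph0Categorical S) (ρ : Con S)
    (h : (∀ φ : S ≃* S, ∀ a b : S, ρ a b ↔ ρ (φ a) (φ b)) ∨
      ∃ F : Set (S × S), F.Finite ∧ ρ = conGen (fun a b : S => (a, b) ∈ F)) :
    Aleph0Categorical ρ.Quotient := by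
  rcases h with h | ⟨F, hF, rfl⟩
  · exact aleph0_quot_aux S hcat ρ 0 Fin.elim0 fun φ _ a b hab => (h φ a b).1 hab
  · obtain ⟨m, c, -, hc⟩ := ((hF.image Prod.fst).union (hF.image Prod.snd)).fin_param
    refine aleph0_quot_aux S hcat _ m c fun φ hφ a b hab => ?_
    have hfix : ∀ x ∈ (Prod.fst '' F ∪ Prod.snd '' F), φ x = x := by
      intro x hx
      rw [← hc] at hx
      obtain ⟨i, rfl⟩ := hx
      exact hφ i
    have hle : conGen (fun a b : S => (a, b) ∈ F) ≤
        Con.comap φ (map_mul φ) (conGen (fun a b : S => (a, b) ∈ F)) := by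
      refine Con.conGen_le.2 fun x y hxy => ?_
      change conGen (fun a b : S => (a, b) ∈ F) (φ x) (φ y)
      rw [hfix x (Or.inl ⟨_, hxy, rfl⟩), hfix y (Or.inr ⟨_, hxy, rfl⟩)]
      exact ConGen.Rel.of _ _ hxy
    exact hle hab
end

section
/- Let S = ⊕_{i∈ℕ} M_i be the direct sum of finite groups M_i. If S is ℵ₀-categorical, then all but finitely many of the groups M_i are abelian. -/
/-- The direct sum `⊕_{i∈ℕ} M i`: the submonoid of the direct product consisting of the
tuples which equal the identity in all but finitely many coordinates. -/
def directSum (M : ℕ → Type*) [∀ i, Monoid (M i)] : Submonoid (∀ i, M i) where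
  carrier := {f | {i | f i ≠ 1}.Finite}
  one_mem' := by simp
  mul_mem' := by
    intro f g hf hg
    apply Set.Finite.subset (hf.union hg)
    intro i hi
    by_contra hc
    simp only [Set.mem_union, Set.mem_setOf_eq] at hc
    push_neg at hc
    simp only [Set.mem_setOf_eq, Pi.mul_apply, hc.1, hc.2, one_mul] at hi
    exact hi rfl

/-- The set of conjugates of `x`, expressed in the language of semigroups. -/
def conjSet {S : Type*} [Semigroup S] (x : S) : Set S := {y | ∃ g, g * x = y * g}

theorem conjSet_image {S : Type*} [Semigroup S] (φ : S ≃* S) (x : S) :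
    φ '' conjSet x = conjSet (φ x) := by
  ext y
  constructor
  · rintro ⟨z, ⟨g, hg⟩, rfl⟩
    exact ⟨φ g, by rw [← map_mul, hg, map_mul]⟩
  · rintro ⟨g, hg⟩
    refine ⟨φ.symm y, ⟨φ.symm g, ?_⟩, by simp⟩
    apply φ.injective
    simpa using hg

theorem conjSet_finite (M : ℕ → Type*) [∀ i, Group (M i)]
    [∀ i, Finite (M i)] (x : directSum M) : (conjSet x).Finite := by
  have hx : {i | x.1 i ≠ 1}.Finite := x.2
  have : Finite {i | x.1 i ≠ 1} := hx
  let r : directSum M → (∀ i : {i | x.1 i ≠ 1}, M i) := fun y i => y.1 i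
  apply Set.Finite.of_finite_image (f := r) (Set.toFinite _)
  have key : ∀ y ∈ conjSet x, ∀ i, x.1 i = 1 → y.1 i = 1 := by
    rintro y ⟨g, hg⟩ i hi
    have h := congrFun (congrArg Subtype.val hg) i
    simp only [Submonoid.coe_mul, Pi.mul_apply, hi, mul_one] at h
    exact right_eq_mul.mp h
  intro y hy z hz hyz
  ext i
  by_cases hi : x.1 i = 1
  · rw [key y hy i hi, key z hz i hi]
  · exact congrFun hyz ⟨i, hi⟩

/-- If the direct sum `⊕_{i∈ℕ} M i` of finite groups `M i` is ℵ₀-categorical, then all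
but finitely many of the groups `M i` are abelian. -/
theorem aleph0Categorical_directSum_groups (M : ℕ → Type*) [∀ i, Group (M i)]
    [∀ i, Finite (M i)]
    (hcat : Aleph0Categorical (directSum M)) :
    {i : ℕ | ∃ a b : M i, a * b ≠ b * a}.Finite := by
  classical
  by_contra hinf
  obtain ⟨t, ht, hcov⟩ := hcat 1 le_rfl
  obtain ⟨N, hN⟩ := (ht.image (fun b => (conjSet (b 0)).ncard)).bddAbove
  obtain ⟨F, hF, hFc⟩ := Set.Infinite.exists_subset_card_eq hinf (N + 1)
  have hab : ∀ i, ∃ a b : M i, i ∈ F → a * b ≠ b * a := by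
    intro i
    by_cases hi : i ∈ F
    · obtain ⟨a, b, h⟩ := hF hi
      exact ⟨a, b, fun _ => h⟩
    · exact ⟨1, 1, fun h => absurd h hi⟩
  choose a b hab using hab
  let x : directSum M := ⟨fun i => if i ∈ F then a i else 1, by
    apply F.finite_toSet.subset
    intro i hi
    by_contra hc
    exact hi (if_neg hc)⟩
  let g : ℕ → directSum M := fun j => ⟨Function.update 1 j (b j), by
    apply (Set.finite_singleton j).subset
    intro i hi
    by_contra hc
    exact hi (by rw [Function.update_of_ne hc]; rfl)⟩
  let y : ℕ → directSum M := fun j => ⟨Function.update x.1 j (b j * x.1 j * (b j)⁻¹), by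
    apply (x.2.union (Set.finite_singleton j)).subset
    intro i hi
    by_contra hc
    simp only [Set.mem_union, Set.mem_singleton_iff, not_or] at hc
    refine hi ?_
    rw [Function.update_of_ne hc.2]
    exact not_not.mp hc.1⟩
  have hy : ∀ j, y j ∈ conjSet x := by
    intro j
    refine ⟨g j, ?_⟩
    ext i
    change Function.update (1 : ∀ i, M i) j (b j) i * x.1 i
      = Function.update x.1 j (b j * x.1 j * (b j)⁻¹) i * Function.update (1 : ∀ i, M i) j (b j) i
    by_cases h : i = j
    · subst h
      simp
    · simp [Function.update_of_ne h]
  have hinj : Set.InjOn y F := by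
    intro j hj k hk hjk
    by_contra hne
    have h := congrFun (congrArg Subtype.val hjk) j
    change Function.update x.1 j (b j * x.1 j * (b j)⁻¹) j
      = Function.update x.1 k (b k * x.1 k * (b k)⁻¹) j at h
    have hxj : x.1 j = a j := if_pos hj
    rw [Function.update_self, Function.update_of_ne hne, hxj, mul_inv_eq_iff_eq_mul] at h
    exact hab j hj h.symm
  have h1 : N + 1 ≤ (conjSet x).ncard := by
    rw [← hFc, ← Set.ncard_coe_finset]
    exact Set.ncard_le_ncard_of_injOn y (fun j _ => hy j) hinj (conjSet_finite M x)
  obtain ⟨c, hc, φ, hφ⟩ := hcov (fun _ => x)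
  have h2 : (conjSet (c 0)).ncard ≤ N := hN ⟨c, hc, rfl⟩
  have hφ0 : φ (c 0) = x := hφ 0
  rw [← hφ0, ← conjSet_image, Set.ncard_image_of_injective _ φ.injective] at h1
  omega
end

section
/- Let S = ⊕_{i∈ℕ} M_i be the direct sum of finite monoids M_i. Then S is ℵ₀-categorical if and only if S is isomorphic (as a monoid) to a direct product M × W, where M is a finite monoid and W is an abelian group of finite exponent. -/
section CatToC
variable {M : ℕ → Type*} [∀ i, Monoid (M i)]

lemma catKey [∀ i, Finite (M i)] (hS : Aleph0Categorical (directSum M))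
    (R : directSum M → directSum M → Prop) (Ri : ∀ i, M i → M i → Prop)
    (hR : ∀ f g, R f g ↔ ∀ i, Ri i (f.1 i) (g.1 i))
    (h1 : ∀ i g, Ri i 1 g ↔ g = 1)
    (hinv : ∀ φ : directSum M ≃* directSum M, ∀ f g, R f g → R (φ f) (φ g)) :
    {i | ∃ m g h, Ri i m g ∧ Ri i m h ∧ g ≠ h}.Finite := by
  classical
  by_contra hinf
  obtain ⟨t, ht, hcov⟩ := hS 1 le_rfl
  have hbound : ∀ f, {g | R f g}.ncard ≤ ∑ b ∈ ht.toFinset, {g | R (b 0) g}.ncard := by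
    intro f
    obtain ⟨b, hb, φ, hφ⟩ := hcov (fun _ => f)
    have : {g | R f g} = φ '' {g | R (b 0) g} := by
      have h0 : φ (b 0) = f := hφ 0
      ext g
      constructor
      · intro hg
        refine ⟨φ.symm g, ?_, by simp⟩
        have := hinv φ.symm _ _ hg
        rw [← h0] at this
        simpa using this
      · rintro ⟨g, hg, rfl⟩
        have := hinv φ _ _ hg
        rwa [h0] at this
    rw [this, Set.ncard_image_of_injective _ φ.injective]
    exact Finset.single_le_sum (f := fun b => {g | R (b 0) g}.ncard) (fun _ _ => Nat.zero_le _)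
      (ht.mem_toFinset.2 hb)
  generalize (∑ b ∈ ht.toFinset, {g | R (b 0) g}.ncard) = B at hbound
  obtain ⟨J, hJ, hcard⟩ := Set.Infinite.exists_subset_card_eq hinf (B + 1)
  have hch : ∀ i, ∃ m g h, i ∈ J → Ri i m g ∧ Ri i m h ∧ g ≠ h := by
    intro i
    by_cases hi : i ∈ J
    · obtain ⟨m, g, h, hh⟩ := hJ hi
      exact ⟨m, g, h, fun _ => hh⟩
    · exact ⟨1, 1, 1, fun h => absurd h hi⟩
  choose m g h hh using hch
  have mem : ∀ f : ∀ i, M i, (∀ i, i ∉ J → f i = 1) → f ∈ directSum M := by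
    intro f hf
    refine J.finite_toSet.subset ?_
    intro i hi
    by_contra hc
    exact hi (hf i hc)
  let f : directSum M := ⟨fun i => if i ∈ J then m i else 1, mem _ (by intro i hi; simp [hi])⟩
  let G : ℕ → directSum M := fun j =>
    ⟨fun i => if i ∈ J then (if i = j then h i else g i) else 1,
      mem _ (by intro i hi; simp [hi])⟩
  have hG : ∀ j, R f (G j) := by
    intro j
    rw [hR]
    intro i
    simp only [f, G]
    split_ifs with h2 h3
    · exact (hh i h2).2.1
    · exact (hh i h2).1
    · exact (h1 _ _).2 rfl
  have hGinj : Set.InjOn G J := by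
    intro j hj k hk e
    by_contra hne
    have := congrFun (congrArg Subtype.val e) j
    simp only [G] at this
    have hj' : j ∈ J := hj
    simp only [hj', hne, if_true, if_false] at this
    exact (hh j hj).2.2 this.symm
  have hfin : {g | R f g}.Finite := by
    refine Set.Finite.of_injOn (f := fun (g : directSum M) (i : J) => g.1 i)
      (t := Set.univ) (fun _ _ => Set.mem_univ _) ?_ Set.finite_univ
    intro x hx y hy e
    ext i
    by_cases hi : i ∈ J
    · exact congrFun e ⟨i, hi⟩
    · have hx := (hR _ _).1 hx i
      have hy := (hR _ _).1 hy i
      simp only [f, if_neg hi] at hx hy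
      rw [(h1 _ _).1 hx, (h1 _ _).1 hy]
  have h3 : ((J : Set ℕ).ncard) ≤ {g | R f g}.ncard :=
    Set.ncard_le_ncard_of_injOn G (fun j _ => hG j) hGinj hfin
  rw [Set.ncard_coe_finset, hcard] at h3
  have := hbound f
  omega

/-- The structural condition. -/
def CondC (M : ℕ → Type*) [∀ i, Monoid (M i)] : Prop :=
  ∃ N n : ℕ, 1 ≤ n ∧ ∀ i, N ≤ i → ∀ x y : M i, x * y = y * x ∧ x ^ n = 1

lemma mulSingle_mem (i : ℕ) (x : M i) : Pi.mulSingle i x ∈ directSum M := by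
  refine (Set.finite_singleton i).subset ?_
  intro j hj
  by_contra hc
  exact hj (Pi.mulSingle_eq_of_ne hc x)

lemma cat_imp_C [∀ i, Finite (M i)] (hS : Aleph0Categorical (directSum M)) : CondC M := by
  classical
  have hA := catKey hS (fun f g => f * g = f) (fun i m g => m * g = m)
    (by intro f g; rw [Subtype.ext_iff, funext_iff]; rfl) (by simp)
    (by intro φ f g h; rw [← map_mul, h])
  have hB := catKey hS (fun f g => ∃ u v, u * v = 1 ∧ v * u = 1 ∧ u * f * v = g)
    (fun i f g => ∃ u v, u * v = 1 ∧ v * u = 1 ∧ u * f * v = g)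
    (by
      intro f g
      constructor
      · rintro ⟨u, v, h1, h2, rfl⟩ i
        exact ⟨u.1 i, v.1 i, congrFun (congrArg Subtype.val h1) i,
          congrFun (congrArg Subtype.val h2) i, rfl⟩
      · intro h
        choose u v h1 h2 h3 using h
        have memu : ∀ w : ∀ i, M i, (fun i => if f.1 i = 1 then 1 else w i) ∈ directSum M := by
          intro w
          refine Set.Finite.subset f.2 ?_
          intro i hi hc
          exact hi (if_pos hc)
        refine ⟨⟨_, memu u⟩, ⟨_, memu v⟩, ?_, ?_, ?_⟩
        · ext i
          by_cases hf : f.1 i = 1 <;> simp [hf, h1]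
        · ext i
          by_cases hf : f.1 i = 1 <;> simp [hf, h2]
        · ext i
          by_cases hf : f.1 i = 1
          · have := h3 i
            simp [hf, h1] at this
            simpa [hf] using this
          · simp [hf, h3])
    (by
      intro i g
      constructor
      · rintro ⟨u, v, h1, h2, h3⟩
        rw [← h3, mul_one, h1]
      · rintro rfl
        exact ⟨1, 1, by simp⟩)
    (by
      rintro φ f g ⟨u, v, h1, h2, rfl⟩
      have e1 : φ 1 = 1 := map_one φ
      exact ⟨φ u, φ v, by rw [← map_mul, h1, e1], by rw [← map_mul, h2, e1], by simp⟩)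
  obtain ⟨N, hN⟩ := (hA.union hB).bddAbove
  have hinv : ∀ i, N < i → ∀ x : M i, ∃ y, x * y = 1 ∧ y * x = 1 := by
    intro i hi
    have hcan : ∀ m g : M i, m * g = m → g = 1 := by
      intro m g hg
      by_contra hne
      have := hN (Or.inl ⟨m, g, 1, hg, mul_one m, hne⟩)
      omega
    intro x
    obtain ⟨a, b, hab, hp⟩ : ∃ a b : ℕ, a < b ∧ x ^ a = x ^ b := by
      obtain ⟨a, b, hne, h⟩ := Finite.exists_ne_map_eq_of_infinite (fun k : ℕ => x ^ k)
      rcases lt_or_gt_of_ne hne with h' | h'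
      · exact ⟨a, b, h', h⟩
      · exact ⟨b, a, h', h.symm⟩
    obtain ⟨c, rfl⟩ := Nat.exists_eq_add_of_lt hab
    have : x ^ (c + 1) = 1 := hcan (x ^ a) _ (by rw [← pow_add, ← add_assoc, hp])
    exact ⟨x ^ c, by rw [← pow_succ', this], by rw [← pow_succ, this]⟩
  have hcomm : ∀ i, N < i → ∀ x y : M i, x * y = y * x := by
    intro i hi x y
    obtain ⟨z, h1, h2⟩ := hinv i hi x
    by_contra hne
    have := hN (Or.inr ⟨y, y, x * y * z, ⟨1, 1, by simp⟩, ⟨x, z, h1, h2, rfl⟩, ?_⟩)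
    · omega
    · intro h
      apply hne
      conv_rhs => rw [h]
      rw [mul_assoc (x * y), h2, mul_one]
  -- exponent
  obtain ⟨t, ht, hcov⟩ := hS 1 le_rfl
  have hpow : ∀ b : directSum M, ∃ k, 1 ≤ k ∧ ((∃ j, 1 ≤ j ∧ b ^ j = 1) → b ^ k = 1) := by
    intro b
    by_cases h : ∃ j, 1 ≤ j ∧ b ^ j = 1
    · obtain ⟨j, hj, h'⟩ := h
      exact ⟨j, hj, fun _ => h'⟩
    · exact ⟨1, le_rfl, fun h' => absurd h' h⟩
  choose k hk1 hk using hpow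
  refine ⟨N + 1, ∏ b ∈ ht.toFinset, k (b 0), Finset.one_le_prod' (fun b _ => hk1 _), ?_⟩
  intro i hi x y
  refine ⟨hcomm i hi x y, ?_⟩
  obtain ⟨b, hb, φ, hφ⟩ := hcov (fun _ => ⟨Pi.mulSingle i x, mulSingle_mem i x⟩)
  have h0 := hφ 0
  have e1 : φ 1 = 1 := map_one φ
  have hxf : ∃ j, 1 ≤ j ∧ x ^ j = 1 := by
    obtain ⟨a, b, hab, hp⟩ : ∃ a b : ℕ, a < b ∧ x ^ a = x ^ b := by
      obtain ⟨a, b, hne, h⟩ := Finite.exists_ne_map_eq_of_infinite (fun k : ℕ => x ^ k)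
      rcases lt_or_gt_of_ne hne with h' | h'
      · exact ⟨a, b, h', h⟩
      · exact ⟨b, a, h', h.symm⟩
    obtain ⟨c, rfl⟩ := Nat.exists_eq_add_of_lt hab
    refine ⟨c + 1, by omega, ?_⟩
    obtain ⟨z, h1, h2⟩ := hinv i hi x
    have hz : z ^ a * x ^ a = 1 := by
      rw [← (show Commute z x from h2.trans h1.symm).mul_pow, h2, one_pow]
    calc x ^ (c + 1) = z ^ a * x ^ a * x ^ (c + 1) := by rw [hz, one_mul]
      _ = z ^ a * x ^ (a + c + 1) := by rw [mul_assoc, ← pow_add, add_assoc]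
      _ = 1 := by rw [← hp, hz]
  have key : ∀ j, (b 0) ^ j = 1 ↔ x ^ j = 1 := by
    intro j
    rw [← φ.injective.eq_iff, map_pow, h0, e1, Subtype.ext_iff]
    simp only [SubmonoidClass.coe_pow, OneMemClass.coe_one]
    rw [← Pi.mulSingle_pow, Pi.mulSingle_eq_one_iff]
  obtain ⟨j, hj, hxj⟩ := hxf
  have := (key _).1 (hk (b 0) ⟨j, hj, (key j).2 hxj⟩)
  obtain ⟨c, hc⟩ := Finset.dvd_prod_of_mem (fun b : Fin 1 → directSum M => k (b 0)) (ht.mem_toFinset.2 hb)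
  rw [hc, pow_mul, this, one_pow]

lemma prod_imp_C {P W : Type*} [Monoid P] [CommGroup W] [Finite P] (n : ℕ) (hn : 1 ≤ n)
    (hW : ∀ w : W, w ^ n = 1) (φ : directSum M ≃* P × W) : CondC M := by
  classical
  let s : ∀ i, M i → directSum M := fun i x => ⟨Pi.mulSingle i x, mulSingle_mem i x⟩
  have hss : ∀ i j, i ≠ j → ∀ x y, s i x * s j y = s j y * s i x := by
    intro i j hij x y
    ext1
    exact Pi.mulSingle_commute hij x y
  have hA : {i | ∃ x y : M i, x * y ≠ y * x}.Finite := by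
    have hch : ∀ i, ∃ x y : M i, (∃ x y : M i, x * y ≠ y * x) → x * y ≠ y * x := by
      intro i
      by_cases h : ∃ x y : M i, x * y ≠ y * x
      · obtain ⟨x, y, h⟩ := h
        exact ⟨x, y, fun _ => h⟩
      · exact ⟨1, 1, fun h' => absurd h' h⟩
    choose x y hxy using hch
    refine Set.Finite.of_injOn (f := fun i => ((φ (s i (x i))).1, (φ (s i (y i))).1))
      (t := Set.univ) (fun _ _ => Set.mem_univ _) ?_ Set.finite_univ
    intro i hi j hj e
    by_contra hne
    apply hxy i hi
    simp only [Prod.mk.injEq] at e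
    have h1 := congrArg (fun z => (φ z).1) (hss i j hne (x i) (y j))
    simp only [map_mul, Prod.fst_mul, ← e.2] at h1
    have h2 : s i (x i) * s i (y i) = s i (y i) * s i (x i) := by
      apply φ.injective
      rw [map_mul, map_mul]
      exact Prod.ext h1 (mul_comm _ _)
    have := congrFun (congrArg Subtype.val h2) i
    simpa [s] using this
  have hB : {i | ∃ x : M i, x ^ n ≠ 1}.Finite := by
    have hch : ∀ i, ∃ x : M i, (∃ x : M i, x ^ n ≠ 1) → x ^ n ≠ 1 := by
      intro i
      by_cases h : ∃ x : M i, x ^ n ≠ 1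
      · obtain ⟨x, h⟩ := h
        exact ⟨x, fun _ => h⟩
      · exact ⟨1, fun h' => absurd h' h⟩
    choose x hx using hch
    refine Set.Finite.of_injOn (f := fun i => (φ (s i (x i))).1)
      (t := Set.univ) (fun _ _ => Set.mem_univ _) ?_ Set.finite_univ
    intro i hi j hj e
    by_contra hne
    apply hx i hi
    have h2 : s i (x i) ^ n = s j (x j) ^ n := by
      apply φ.injective
      rw [map_pow, map_pow]
      refine Prod.ext ?_ ?_
      · simp only [Prod.pow_fst]
        exact congrArg (· ^ n) e
      · simp only [Prod.pow_snd, hW]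
    have := congrFun (congrArg Subtype.val h2) i
    simpa [s, hne] using this
  obtain ⟨N, hN⟩ := (hA.union hB).bddAbove
  refine ⟨N + 1, n, hn, fun i hi x y => ⟨?_, ?_⟩⟩
  · by_contra h
    have := hN (Or.inl ⟨x, y, h⟩)
    omega
  · by_contra h
    have := hN (Or.inr ⟨x, h⟩)
    omega

end CatToC

section CToCat

lemma cat_of_equiv {S T : Type*} [Semigroup S] [Semigroup T] (e : S ≃* T)
    (h : Aleph0Categorical S) : Aleph0Categorical T := by
  intro n hn
  obtain ⟨t, ht, hc⟩ := h n hn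
  refine ⟨(fun b k => e (b k)) '' t, ht.image _, fun a => ?_⟩
  obtain ⟨b, hb, φ, hφ⟩ := hc (fun k => e.symm (a k))
  exact ⟨_, ⟨b, hb, rfl⟩, (e.symm.trans φ).trans e, fun k => by simp [hφ]⟩

lemma cat_of_finite {S : Type*} [Semigroup S] [Finite S] : Aleph0Categorical S :=
  fun _ _ => ⟨Set.univ, Set.finite_univ, fun a => ⟨a, trivial, MulEquiv.refl S, fun _ => rfl⟩⟩

lemma cat_pi {ι : Type*} [Finite ι] {S : ι → Type*} [∀ i, Semigroup (S i)]
    (h : ∀ i, Aleph0Categorical (S i)) : Aleph0Categorical (∀ i, S i) := by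
  intro n hn
  choose t ht hc using fun i => h i n hn
  refine ⟨(fun b k i => b i k) '' (Set.pi Set.univ t), (Set.Finite.pi' ht |>.subset ?_).image _,
    fun a => ?_⟩
  · intro x hx i
    exact hx i trivial
  · choose b hb φ hφ using fun i => hc i (fun k => a k i)
    exact ⟨_, ⟨b, fun i _ => hb i, rfl⟩, MulEquiv.piCongrRight φ, fun k => by
      funext i; exact hφ i k⟩

lemma cat_prod {S T : Type*} [Semigroup S] [Semigroup T]
    (hS : Aleph0Categorical S) (hT : Aleph0Categorical T) : Aleph0Categorical (S × T) := by
  intro n hn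
  obtain ⟨t, ht, hc⟩ := hS n hn
  obtain ⟨t', ht', hc'⟩ := hT n hn
  refine ⟨(fun b k => (b.1 k, b.2 k)) '' (t ×ˢ t'), (ht.prod ht').image _, fun a => ?_⟩
  obtain ⟨b, hb, φ, hφ⟩ := hc (fun k => (a k).1)
  obtain ⟨b', hb', φ', hφ'⟩ := hc' (fun k => (a k).2)
  refine ⟨_, ⟨(b, b'), ⟨hb, hb'⟩, rfl⟩, { Equiv.prodCongr φ.toEquiv φ'.toEquiv with
      map_mul' := fun x y => Prod.ext (map_mul φ x.1 y.1) (map_mul φ' x.2 y.2) }, fun k => ?_⟩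
  exact Prod.ext (hφ k) (hφ' k)

/-- The set of nonzero columns. -/
def colSet {K R : Type*} [AddCommGroup R] {m : ℕ} (a : Fin m → K →₀ R) : Set (Fin m → R) :=
  {c | c ≠ 0 ∧ ∃ k, (fun i => a i k) = c}

lemma finsupp_reduce {K R : Type*} [AddCommGroup R] {m : ℕ} (a : Fin m → K →₀ R) :
    ∃ (φ : (K →₀ R) ≃+ (K →₀ R)) (ι : colSet a ↪ K),
      (∀ i c, φ (a i) (ι c) = c.1 i) ∧ ∀ i k, k ∉ Set.range ι → φ (a i) k = 0 := by
  classical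
  choose r0 hr0 using fun c : colSet a => c.2.2
  have hinj : Function.Injective r0 := by
    intro c d h
    ext1
    rw [← hr0 c, ← hr0 d, h]
  have hfin : {k | (fun i => a i k) ≠ 0 ∧ k ∉ Set.range r0}.Finite := by
    refine (Set.finite_iUnion (fun i => (a i).support.finite_toSet)).subset ?_
    rintro k ⟨hk, -⟩
    by_contra hc
    apply hk
    funext i
    simp only [Set.mem_iUnion, not_exists, Finset.mem_coe, Finsupp.mem_support_iff, not_not] at hc
    exact hc i
  let r : K → K := fun k => if h : (fun i => a i k) ∈ colSet a then r0 ⟨_, h⟩ else k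
  have hr : ∀ k, k ∈ hfin.toFinset → r k ∈ Set.range r0 ∧ ∀ i, a i (r k) = a i k := by
    intro k hk
    have hk' := (hfin.mem_toFinset.1 hk).1
    have hm : (fun i => a i k) ∈ colSet a := ⟨hk', k, rfl⟩
    have : r k = r0 ⟨_, hm⟩ := dif_pos hm
    rw [this]
    exact ⟨⟨_, rfl⟩, fun i => congrFun (hr0 ⟨_, hm⟩) i⟩
  let D : (K →₀ R) →+ (K →₀ R) :=
    ∑ j ∈ hfin.toFinset, (Finsupp.singleAddHom j).comp (Finsupp.applyAddHom (r j))
  have hD : ∀ x k, D x k = if k ∈ hfin.toFinset then x (r k) else 0 := by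
    intro x k
    simp only [D, AddMonoidHom.finsetSum_apply, AddMonoidHom.comp_apply,
      Finsupp.singleAddHom_apply, Finsupp.applyAddHom_apply, Finsupp.finsetSum_apply,
      Finsupp.single_apply]
    rw [Finset.sum_ite_eq']
  have hDr : ∀ x k, k ∈ Set.range r0 → D x k = 0 := by
    intro x k hk
    rw [hD, if_neg]
    intro h
    exact (hfin.mem_toFinset.1 h).2 hk
  have hDD : ∀ x, D (D x) = 0 := by
    intro x
    ext k
    rw [hD]
    split_ifs with h
    · exact hDr _ _ (hr k h).1
    · rfl
  let φ : (K →₀ R) ≃+ (K →₀ R) :=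
    { toFun := fun x => x - D x
      invFun := fun x => x + D x
      left_inv := fun x => by simp [hDD]
      right_inv := fun x => by simp [hDD]
      map_add' := fun x y => by simp only [map_add]; abel }
  have hφ : ∀ x k, φ x k = x k - D x k := fun x k => rfl
  refine ⟨φ, ⟨r0, hinj⟩, ?_, ?_⟩
  · intro i c
    rw [hφ]
    simp only [Function.Embedding.coeFn_mk]
    rw [hDr _ _ ⟨c, rfl⟩, sub_zero]
    exact congrFun (hr0 c) i
  · intro i k hk
    rw [hφ, hD]
    split_ifs with h
    · rw [(hr k h).2, sub_self]
    · have : (fun i => a i k) = 0 := by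
        by_contra hne
        exact h (hfin.mem_toFinset.2 ⟨hne, hk⟩)
      rw [sub_zero]
      exact congrFun this i

lemma finsupp_equiv {K R : Type*} [AddCommGroup R] [Finite R] {m : ℕ} (a b : Fin m → K →₀ R)
    (h : colSet a = colSet b) : ∃ φ : (K →₀ R) ≃+ (K →₀ R), ∀ i, φ (a i) = b i := by
  classical
  obtain ⟨φ, ι, h1, h2⟩ := finsupp_reduce a
  have hb := finsupp_reduce b
  rw [← h] at hb
  obtain ⟨ψ, κ, h3, h4⟩ := hb
  obtain ⟨n, ⟨e⟩⟩ := Finite.exists_equiv_fin (colSet a)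
  obtain ⟨σ, hσ⟩ := (Equiv.Perm.isMultiplyPretransitive K n).exists_smul_eq
    (e.symm.toEmbedding.trans ι) (e.symm.toEmbedding.trans κ)
  have hσ' : ∀ c, σ (ι c) = κ c := by
    intro c
    have := DFunLike.congr_fun hσ (e c)
    simpa using this
  refine ⟨(φ.trans (Finsupp.domCongr σ)).trans ψ.symm, fun i => ?_⟩
  simp only [AddEquiv.trans_apply]
  rw [AddEquiv.symm_apply_eq]
  ext k
  rw [Finsupp.domCongr_apply, Finsupp.equivMapDomain_apply]
  by_cases hk : k ∈ Set.range κ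
  · obtain ⟨c, rfl⟩ := hk
    rw [← hσ', Equiv.symm_apply_apply, hσ', h1, h3]
  · rw [h4 i k hk, h2]
    rintro ⟨c, hc⟩
    exact hk ⟨c, by rw [← hσ', hc, Equiv.apply_symm_apply]⟩

lemma cat_finsupp {K R : Type*} [AddCommGroup R] [Finite R] :
    Aleph0Categorical (Multiplicative (K →₀ R)) := by
  intro m _
  let inv : (Fin m → K →₀ R) → Set (Fin m → R) := colSet
  choose s hs using fun y : Set.range inv => y.2
  refine ⟨Set.range (fun y k => Multiplicative.ofAdd (s y k)), Set.finite_range _, fun a => ?_⟩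
  obtain ⟨φ, hφ⟩ := finsupp_equiv (s ⟨inv (fun k => (a k).toAdd), _, rfl⟩)
    (fun k => (a k).toAdd) (hs ⟨inv (fun k => (a k).toAdd), _, rfl⟩)
  refine ⟨_, ⟨⟨inv (fun k => (a k).toAdd), _, rfl⟩, rfl⟩, AddEquiv.toMultiplicative φ, fun k => ?_⟩
  exact congrArg Multiplicative.ofAdd (hφ k)

open DirectSum in
lemma cat_dirsum {G : ℕ → Type*} [∀ i, AddCommGroup (G i)] [∀ i, Finite (G i)] (n : ℕ)
    (hn : 1 ≤ n) (hG : ∀ i (x : G i), n • x = 0) :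
    Aleph0Categorical (Multiplicative (⨁ i, G i)) := by
  classical
  choose ι hι q hq e using fun i => AddCommGroup.equiv_directSum_zmod_of_finite' (G i)
  have hqn : ∀ i j, q i j ≤ n := by
    intro i j
    apply Nat.le_of_dvd hn
    rw [← ZMod.natCast_eq_zero_iff]
    have h1 := hG i ((e i).some.symm (DirectSum.of (fun j => ZMod (q i j)) j 1))
    rw [← map_nsmul, EmbeddingLike.map_eq_zero_iff, ← map_nsmul] at h1
    have h2 := DFunLike.congr_fun h1 j
    rw [DirectSum.of_eq_same] at h2
    have h3 : n • (1 : ZMod (q i j)) = 0 := h2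
    simpa using h3
  let f : (Σ i, ι i) → Fin n := fun p => ⟨q p.1 p.2 - 1, by
    have := hqn p.1 p.2
    have := hq p.1 p.2
    omega⟩
  have hf : ∀ d, ∀ p : {p // f p = d}, q p.1.1 p.1.2 = d + 1 := by
    rintro d ⟨p, rfl⟩
    have := hq p.1 p.2
    simp only [f]
    omega
  let e1 : (⨁ i, G i) ≃+ ⨁ i, ⨁ j, ZMod (q i j) := DFinsupp.mapRange.addEquiv fun i => (e i).some
  let e2 : (⨁ i, ⨁ j, ZMod (q i j)) ≃+ ⨁ p : (Σ i, ι i), ZMod (q p.1 p.2) :=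
    (DirectSum.sigmaCurryEquiv (δ := fun i j => ZMod (q i j))).symm
  let e3 : (⨁ p : (Σ i, ι i), ZMod (q p.1 p.2)) ≃+
      ⨁ d : Fin n, ⨁ p : {p // f p = d}, ZMod (q p.1.1 p.1.2) :=
    DirectSum.sigmaFiberAddEquiv f
  let e4 : (⨁ d : Fin n, ⨁ p : {p // f p = d}, ZMod (q p.1.1 p.1.2)) ≃+
      ⨁ d : Fin n, ({p // f p = d} →₀ ZMod (d + 1)) :=
    DFinsupp.mapRange.addEquiv fun d =>
      (DFinsupp.mapRange.addEquiv fun p => (ZMod.ringEquivCongr (hf d p)).toAddEquiv).trans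
        finsuppAddEquivDFinsupp.symm
  let e5 : (⨁ d : Fin n, ({p // f p = d} →₀ ZMod (d + 1))) ≃+
      ∀ d : Fin n, ({p // f p = d} →₀ ZMod (d + 1)) := DirectSum.addEquivProd _
  let E := (((e1.trans e2).trans e3).trans e4).trans e5
  refine cat_of_equiv ((AddEquiv.toMultiplicative E).trans
    (MulEquiv.piMultiplicative _)).symm (cat_pi fun d => cat_finsupp)

variable {M : ℕ → Type*} [∀ i, Monoid (M i)]

lemma splitEquiv (M : ℕ → Type*) [∀ i, Monoid (M i)] (N : ℕ) :
    Nonempty (directSum M ≃* (∀ i : Fin N, M i) × directSum (fun i => M (N + i))) := by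
  let F : directSum M →* (∀ i : Fin N, M i) × directSum (fun i => M (N + i)) :=
    { toFun := fun f => (fun i => f.1 i, ⟨fun i => f.1 (N + i),
        Set.Finite.preimage (s := {i | f.1 i ≠ 1}) (f := fun i => N + i)
          (fun _ _ _ _ h => Nat.add_left_cancel h) f.2⟩)
      map_one' := rfl
      map_mul' := fun _ _ => rfl }
  refine ⟨MulEquiv.ofBijective F ⟨?_, ?_⟩⟩
  · intro f g h
    have h1 : ∀ i : Fin N, f.1 i = g.1 i := fun i => congrFun (congrArg Prod.fst h) i
    have h2 : ∀ i, f.1 (N + i) = g.1 (N + i) := fun i =>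
      congrFun (congrArg Subtype.val (congrArg Prod.snd h)) i
    ext i
    by_cases hi : i < N
    · exact h1 ⟨i, hi⟩
    · obtain ⟨j, rfl⟩ := Nat.exists_eq_add_of_le (Nat.le_of_not_lt hi)
      exact h2 j
  · rintro ⟨p, w⟩
    have : ∀ i, ∃ x : M i, (∀ h : i < N, x = p ⟨i, h⟩) ∧ ∀ j, N + j = i → HEq x (w.1 j) := by
      intro i
      by_cases hi : i < N
      · exact ⟨p ⟨i, hi⟩, fun _ => rfl, fun j hj => by omega⟩
      · obtain ⟨j, rfl⟩ := Nat.exists_eq_add_of_le (Nat.le_of_not_lt hi)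
        refine ⟨w.1 j, fun h => absurd h hi, fun k hk => ?_⟩
        obtain rfl := Nat.add_left_cancel hk
        rfl
    choose f hf1 hf2 using this
    have hf2' : ∀ j, f (N + j) = w.1 j := fun j => eq_of_heq (hf2 _ j rfl)
    refine ⟨⟨f, ?_⟩, ?_⟩
    · refine ((Set.finite_lt_nat N).union (w.2.image (fun i => N + i))).subset ?_
      intro i hi
      by_cases h : i < N
      · exact Or.inl h
      · right
        obtain ⟨j, rfl⟩ := Nat.exists_eq_add_of_le (Nat.le_of_not_lt h)
        refine ⟨j, ?_, rfl⟩
        intro hc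
        exact hi ((hf2' j).trans hc)
    · refine Prod.ext (funext fun i => hf1 i i.2) (Subtype.ext (funext fun j => hf2' j))

open DirectSum in
lemma cat_tail {G : ℕ → Type*} [∀ i, CommGroup (G i)] [∀ i, Finite (G i)] (n : ℕ)
    (hn : 1 ≤ n) (hG : ∀ i (x : G i), x ^ n = 1) : Aleph0Categorical (directSum G) := by
  classical
  have h1 : Aleph0Categorical (Multiplicative (⨁ i, Additive (G i))) :=
    cat_dirsum n hn (fun i x => hG i x.toMul)
  let F : Multiplicative (⨁ i, Additive (G i)) →* directSum G :=
    { toFun := fun x => ⟨fun i => (x.toAdd i).toMul, by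
        refine (DFinsupp.finite_support x.toAdd).subset ?_
        intro i hi hc
        exact hi hc⟩
      map_one' := rfl
      map_mul' := fun _ _ => rfl }
  refine cat_of_equiv (MulEquiv.ofBijective F ⟨?_, ?_⟩) h1
  · intro x y h
    refine Multiplicative.toAdd.injective (DFinsupp.ext fun i => ?_)
    exact congrFun (congrArg Subtype.val h) i
  · intro f
    refine ⟨Multiplicative.ofAdd (DFinsupp.mk (β := fun i => Additive (G i)) (Set.Finite.toFinset f.2)
      fun i => Additive.ofMul (f.1 i)), ?_⟩
    ext i
    change Additive.toMul ((DFinsupp.mk (β := fun i => Additive (G i)) (Set.Finite.toFinset f.2)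
      fun i => Additive.ofMul (f.1 i)) i) = f.1 i
    rw [DFinsupp.mk_apply]
    split_ifs with h
    · rfl
    · have : f.1 i = 1 := by
        by_contra hc
        exact h ((Set.Finite.mem_toFinset _).2 hc)
      rw [this]
      rfl

lemma C_imp_cat [∀ i, Finite (M i)] (h : CondC M) : Aleph0Categorical (directSum M) := by
  obtain ⟨N, n, hn, h⟩ := h
  obtain ⟨e⟩ := splitEquiv M N
  refine cat_of_equiv e.symm (cat_prod cat_of_finite ?_)
  let inst : ∀ i, CommGroup (M (N + i)) := fun i =>
    { (inferInstance : Monoid (M (N + i))) with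
      inv := fun x => x ^ (n - 1)
      inv_mul_cancel := fun x => by
        change x ^ (n - 1) * x = 1
        rw [← pow_succ, Nat.sub_add_cancel hn]
        exact (h _ (by omega) x x).2
      mul_comm := fun x y => (h _ (by omega) x y).1 }
  exact @cat_tail (fun i => M (N + i)) inst _ n hn (fun i x => (h _ (by omega) x x).2)

lemma countable_directSum [∀ i, Finite (M i)] : Countable (directSum M) := by
  classical
  let F : (Σ s : Finset ℕ, ∀ i : s, M i) → directSum M := fun p =>
    ⟨fun i => if h : i ∈ p.1 then p.2 ⟨i, h⟩ else 1, by
      refine p.1.finite_toSet.subset ?_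
      intro i hi
      by_contra hc
      exact hi (dif_neg hc)⟩
  refine Function.Surjective.countable (f := F) ?_
  intro f
  refine ⟨⟨Set.Finite.toFinset f.2, fun i => f.1 i⟩, ?_⟩
  ext i
  by_cases h : f.1 i = 1
  · simp [F, h]
  · exact dif_pos ((Set.Finite.mem_toFinset _).2 h)

lemma C_imp_prod [∀ i, Finite (M i)] (h : CondC M) :
    ∃ (P W : Type) (_ : Monoid P) (_ : CommGroup W),
        Finite P ∧ (∃ n : ℕ, 1 ≤ n ∧ ∀ w : W, w ^ n = 1) ∧
        Nonempty ((directSum M) ≃* (P × W)) := by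
  obtain ⟨N, n, hn, h⟩ := h
  obtain ⟨e⟩ := splitEquiv M N
  have : Countable (directSum fun i => M (N + i)) := countable_directSum
  let T := directSum fun i => M (N + i)
  let eP : Shrink.{0} (∀ i : Fin N, M i) ≃* (∀ i : Fin N, M i) := Shrink.mulEquiv
  let eW : Shrink.{0} T ≃* T := Shrink.mulEquiv
  have hpow : ∀ x : Shrink.{0} T, x ^ n = 1 := by
    intro x
    apply eW.injective
    rw [map_pow, map_one]
    ext i
    exact (h _ (by omega) _ 1).2
  have hcomm : ∀ x y : Shrink.{0} T, x * y = y * x := by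
    intro x y
    apply eW.injective
    rw [map_mul, map_mul]
    ext i
    exact (h _ (by omega) _ _).1
  let inst : CommGroup (Shrink.{0} T) :=
    { (inferInstance : Monoid (Shrink.{0} T)) with
      inv := fun x => x ^ (n - 1)
      inv_mul_cancel := fun x => by
        change x ^ (n - 1) * x = 1
        rw [← pow_succ, Nat.sub_add_cancel hn]
        exact hpow x
      mul_comm := hcomm }
  refine ⟨Shrink.{0} (∀ i : Fin N, M i), Shrink.{0} T, inferInstance, inst,
    Finite.of_equiv _ eP.symm.toEquiv, ⟨n, hn, hpow⟩, ⟨e.trans ?_⟩⟩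
  exact MulEquiv.prodCongr eP.symm eW.symm

end CToCat

/-- The direct sum `S = ⊕_{i∈ℕ} M i` of finite monoids `M i` is ℵ₀-categorical iff `S`
is isomorphic, as a monoid, to a direct product `M × W` of a finite monoid `M` and an
abelian group `W` of finite exponent. -/
theorem aleph0Categorical_directSum_monoids (Mi : ℕ → Type*) [∀ i, Monoid (Mi i)]
    [∀ i, Finite (Mi i)] :
    Aleph0Categorical (directSum Mi) ↔
      ∃ (M W : Type) (_ : Monoid M) (_ : CommGroup W),
        Finite M ∧ (∃ n : ℕ, 1 ≤ n ∧ ∀ w : W, w ^ n = 1) ∧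
        Nonempty ((directSum Mi) ≃* (M × W)) := by
  constructor
  · intro h
    exact C_imp_prod (cat_imp_C h)
  · rintro ⟨M, W, _, _, _, ⟨n, hn, hW⟩, ⟨φ⟩⟩
    exact C_imp_cat (prod_imp_C n hn hW φ)
end

section
/- Let S be a countable semigroup with zero and let 𝒮 = {S_i : i ∈ A} be the greatest 0-direct decomposition of S. Then S is ℵ₀-categorical if and only if each S_i is ℵ₀-categorical and the family {S_i : i ∈ A} contains only finitely many semigroups up to isomorphism. -/
/-- A family of subsemigroups `A i` (each containing the zero `z`) is a 0-direct
decomposition of `S`: each `A i` is different from `{z}`, they cover `S`, and for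
`i ≠ j` we have `A i ∩ A j = {z}` and `A i · A j = {z}`. -/
def IsZeroDirectDecomp (S : Type*) [Semigroup S] (z : S) {ι : Type}
    (A : ι → Subsemigroup S) : Prop :=
  (∀ i, z ∈ A i) ∧ (∀ i, (A i : Set S) ≠ {z}) ∧
  (⋃ i, (A i : Set S)) = Set.univ ∧
  ∀ i j, i ≠ j → (A i : Set S) ∩ (A j : Set S) = {z} ∧
    ∀ x ∈ A i, ∀ y ∈ A j, x * y = z

section Aux

theorem AutRel.symm' {S : Type*} [Semigroup S] {n : ℕ} {a b : Fin n → S} (h : AutRel S a b) :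
    AutRel S b a := by
  obtain ⟨φ, h⟩ := h
  exact ⟨φ.symm, fun k => by rw [← h k]; simp⟩

theorem AutRel.trans' {S : Type*} [Semigroup S] {n : ℕ} {a b c : Fin n → S} (h : AutRel S a b)
    (h' : AutRel S b c) : AutRel S a c := by
  obtain ⟨φ, h⟩ := h
  obtain ⟨ψ, h'⟩ := h'
  exact ⟨φ.trans ψ, fun k => by simp [h, h']⟩

theorem exists_reps {α X : Type*} [Finite X] (I : α → X) :
    ∃ t : Set α, t.Finite ∧ ∀ a, ∃ b ∈ t, I b = I a := by
  refine ⟨Set.range (fun x : Set.range I => x.2.choose), Set.finite_range _, fun a => ?_⟩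
  exact ⟨_, ⟨⟨I a, a, rfl⟩, rfl⟩, (⟨I a, a, rfl⟩ : Set.range I).2.choose_spec⟩

theorem map_zero_elt {S T : Type*} [Semigroup S] [Semigroup T] {z : S} {w : T}
    (hz : ∀ x, z * x = z) (hw : ∀ x, x * w = w) (φ : S ≃* T) : φ z = w := by
  have h1 : φ (z * φ.symm w) = φ z := by rw [hz]
  rw [map_mul, MulEquiv.apply_symm_apply, hw] at h1
  exact h1.symm

theorem decomp_unique {S : Type*} [Semigroup S] {z : S} {ι : Type}
    {A : ι → Subsemigroup S} (hdec : IsZeroDirectDecomp S z A) {x : S} (hx : x ≠ z) {i j : ι}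
    (hi : x ∈ A i) (hj : x ∈ A j) : i = j := by
  by_contra h
  have h1 := (hdec.2.2.2 i j h).1
  have : x ∈ (A i : Set S) ∩ (A j : Set S) := ⟨hi, hj⟩
  rw [h1] at this
  exact hx this

theorem decomp_cover {S : Type*} [Semigroup S] {z : S} {ι : Type}
    {A : ι → Subsemigroup S} (hdec : IsZeroDirectDecomp S z A) (x : S) : ∃ i, x ∈ A i := by
  have : x ∈ (⋃ i, (A i : Set S)) := by rw [hdec.2.2.1]; trivial
  simpa using this

theorem decomp_nonzero {S : Type*} [Semigroup S] {z : S} {ι : Type}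
    {A : ι → Subsemigroup S} (hdec : IsZeroDirectDecomp S z A) (i : ι) :
    ∃ x ∈ A i, x ≠ z := by
  by_contra! h
  apply hdec.2.1 i
  ext x
  exact ⟨fun hx => h x hx, fun hx => by rw [Set.mem_singleton_iff.1 hx]; exact hdec.1 i⟩

theorem decomp_comap {S : Type*} [Semigroup S] {z : S} (hz : ∀ x : S, z * x = z ∧ x * z = z)
    {ι : Type} {A : ι → Subsemigroup S} (hdec : IsZeroDirectDecomp S z A) (φ : S ≃* S) :
    IsZeroDirectDecomp S z (fun i => (A i).comap (φ : S →ₙ* S)) := by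
  have h0 : φ z = z := map_zero_elt (fun x => (hz x).1) (fun x => (hz x).2) φ
  have hinj : ∀ x, φ x = z → x = z := fun x hx => φ.injective (hx.trans h0.symm)
  refine ⟨fun i => ?_, fun i h => ?_, ?_, fun i j hij => ⟨?_, fun x hx y hy => ?_⟩⟩
  · show φ z ∈ A i
    rw [h0]; exact hdec.1 i
  · obtain ⟨x, hx, hne⟩ := decomp_nonzero hdec i
    have : φ.symm x ∈ (((A i).comap (φ : S →ₙ* S) : Subsemigroup S) : Set S) := by
      show φ (φ.symm x) ∈ A i
      simpa using hx
    rw [h] at this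
    apply hne
    rw [← h0, ← Set.mem_singleton_iff.1 this]; simp
  · ext x
    obtain ⟨i, hi⟩ := decomp_cover hdec (φ x)
    simp only [Set.mem_iUnion, Set.mem_univ, iff_true]
    exact ⟨i, hi⟩
  · ext x
    constructor
    · rintro ⟨h1, h2⟩
      by_contra hx
      exact hij (decomp_unique hdec (fun h => hx (hinj x h)) h1 h2)
    · intro hx
      rw [Set.mem_singleton_iff.1 hx]
      constructor
      · show φ z ∈ A i
        rw [h0]; exact hdec.1 i
      · show φ z ∈ A j
        rw [h0]; exact hdec.1 j
  · apply hinj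
    rw [map_mul]
    exact (hdec.2.2.2 i j hij).2 _ hx _ hy

theorem block_map {S : Type*} [Semigroup S] {z : S} (hz : ∀ x : S, z * x = z ∧ x * z = z)
    {ι : Type} {A : ι → Subsemigroup S} (hdec : IsZeroDirectDecomp S z A)
    (hgreatest : ∀ (κ : Type) (B : κ → Subsemigroup S), IsZeroDirectDecomp S z B →
      ∀ i : ι, ∃ k : κ, (A i : Set S) ⊆ (B k : Set S)) (φ : S ≃* S) {i j : ι} {x : S}
    (hx : x ≠ z) (hi : x ∈ A i) (hj : φ x ∈ A j) (y : S) (hy : y ∈ A i) : φ y ∈ A j := by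
  have h0 : φ z = z := map_zero_elt (fun x => (hz x).1) (fun x => (hz x).2) φ
  obtain ⟨k, hk⟩ := hgreatest ι _ (decomp_comap hz hdec φ) i
  have h1 : φ x ∈ A k := hk hi
  have : k = j := decomp_unique hdec (fun h => hx (φ.injective (h.trans h0.symm))) h1 hj
  subst this
  exact hk hy

theorem block_equiv {S : Type*} [Semigroup S] {z : S} (hz : ∀ x : S, z * x = z ∧ x * z = z)
    {ι : Type} {A : ι → Subsemigroup S} (hdec : IsZeroDirectDecomp S z A)
    (hgreatest : ∀ (κ : Type) (B : κ → Subsemigroup S), IsZeroDirectDecomp S z B →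
      ∀ i : ι, ∃ k : κ, (A i : Set S) ⊆ (B k : Set S)) (φ : S ≃* S) {i j : ι} {x : S}
    (hx : x ≠ z) (hi : x ∈ A i) (hj : φ x ∈ A j) :
    ∃ ψ : A i ≃* A j, ∀ y : A i, (ψ y : S) = φ y := by
  have h0 : φ z = z := map_zero_elt (fun x => (hz x).1) (fun x => (hz x).2) φ
  have h1 := block_map hz hdec hgreatest φ hx hi hj
  have h2 := block_map hz hdec hgreatest φ.symm (x := φ x)
    (fun h => hx (φ.injective (h.trans h0.symm))) hj (by simpa using hi)
  exact ⟨{ toFun := fun y => ⟨φ y, h1 _ y.2⟩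
           invFun := fun y => ⟨φ.symm y, h2 _ y.2⟩
           left_inv := fun y => by simp
           right_inv := fun y => by simp
           map_mul' := fun a b => by ext; simp }, fun y => rfl⟩

theorem glue {S : Type*} [Semigroup S] {z : S} (hz : ∀ x : S, z * x = z ∧ x * z = z)
    {ι : Type} {A : ι → Subsemigroup S} (hdec : IsZeroDirectDecomp S z A)
    (σ : Equiv.Perm ι) (ψ : ∀ i, A i ≃* A (σ i)) :
    ∃ Φ : S ≃* S, ∀ i (x : A i), Φ x = ψ i x := by
  have hψ0 : ∀ i, ψ i ⟨z, hdec.1 i⟩ = ⟨z, hdec.1 _⟩ := fun i =>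
    map_zero_elt (fun x => Subtype.ext (hz x).1) (fun x => Subtype.ext (hz x).2) (ψ i)
  have hψi : ∀ i (x : A i), (ψ i x : S) = z → (x : S) = z := by
    intro i x h
    have : ψ i x = ψ i ⟨z, hdec.1 i⟩ := by rw [hψ0]; exact Subtype.ext h
    exact congrArg Subtype.val ((ψ i).injective this)
  have hex : ∀ x : S, ∃ y : S, ∀ i (h : x ∈ A i), y = ψ i ⟨x, h⟩ := by
    intro x
    by_cases hx : x = z
    · subst hx
      exact ⟨x, fun i h => by rw [hψ0]⟩
    · obtain ⟨i, hi⟩ := decomp_cover hdec x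
      refine ⟨ψ i ⟨x, hi⟩, fun j hj => ?_⟩
      have := decomp_unique hdec hx hi hj
      subst this
      rfl
  choose f hf using hex
  have hf0 : f z = z := by
    obtain ⟨i, hi⟩ := decomp_cover hdec z
    rw [hf z i hi, hψ0]
  have hmul : ∀ x y, f (x * y) = f x * f y := by
    intro x y
    obtain ⟨i, hi⟩ := decomp_cover hdec x
    obtain ⟨j, hj⟩ := decomp_cover hdec y
    by_cases hij : i = j
    · subst hij
      rw [hf _ i hi, hf _ i hj, hf _ i (mul_mem hi hj), ← MulMemClass.coe_mul, ← map_mul]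
      rfl
    · rw [(hdec.2.2.2 i j hij).2 x hi y hj, hf0, hf _ i hi, hf _ j hj]
      exact ((hdec.2.2.2 (σ i) (σ j) (fun h => hij (σ.injective h))).2 _ (ψ i _).2 _ (ψ j _).2).symm
  have hinj : Function.Injective f := by
    intro x y hxy
    obtain ⟨i, hi⟩ := decomp_cover hdec x
    obtain ⟨j, hj⟩ := decomp_cover hdec y
    rw [hf _ i hi, hf _ j hj] at hxy
    by_cases hij : i = j
    · subst hij
      exact congrArg Subtype.val ((ψ i).injective (Subtype.ext hxy))
    · have h1 : (ψ i ⟨x, hi⟩ : S) = z := by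
        by_contra hne
        exact hij (σ.injective (decomp_unique hdec hne (ψ i _).2 (by rw [hxy]; exact (ψ j _).2)))
      have h2 := hxy ▸ h1
      exact (hψi i _ h1).trans (hψi j _ h2).symm
  have hsurj : Function.Surjective f := by
    intro y
    obtain ⟨j, hj⟩ := decomp_cover hdec y
    obtain ⟨i, rfl⟩ := σ.surjective j
    refine ⟨(ψ i).symm ⟨y, hj⟩, ?_⟩
    rw [hf _ i ((ψ i).symm ⟨y, hj⟩).2]
    simp
  exact ⟨MulEquiv.ofBijective (⟨f, hmul⟩ : S →ₙ* S) ⟨hinj, hsurj⟩, fun i x => hf x i x.2⟩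

theorem extend_perm {ι C : Type*} (c : ι → C) {n : ℕ} (f g : Fin n → ι)
    (hfg : ∀ k l, f k = f l ↔ g k = g l) (hc : ∀ k, c (f k) = c (g k)) :
    ∃ σ : Equiv.Perm ι, (∀ k, σ (f k) = g k) ∧ ∀ i, c (σ i) = c i := by
  classical
  suffices h : ∀ s : Finset (Fin n), ∃ σ : Equiv.Perm ι, (∀ k ∈ s, σ (f k) = g k) ∧
      ∀ i, c (σ i) = c i by
    obtain ⟨σ, h1, h2⟩ := h Finset.univ
    exact ⟨σ, fun k => h1 k (Finset.mem_univ _), h2⟩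
  intro s
  induction s using Finset.induction_on with
  | empty => exact ⟨1, by simp, by simp⟩
  | insert k s hk ih =>
    obtain ⟨σ, h1, h2⟩ := ih
    by_cases h : ∃ l ∈ s, f k = f l
    · obtain ⟨l, hl, hkl⟩ := h
      refine ⟨σ, fun m hm => ?_, h2⟩
      rcases Finset.mem_insert.1 hm with rfl | hm
      · rw [hkl, h1 l hl]; exact ((hfg _ _).1 hkl).symm
      · exact h1 m hm
    · push Not at h
      refine ⟨Equiv.swap (σ (f k)) (g k) * σ, fun m hm => ?_, fun i => ?_⟩
      · rcases Finset.mem_insert.1 hm with rfl | hm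
        · simp
        · rw [Equiv.Perm.mul_apply, Equiv.swap_apply_of_ne_of_ne, h1 m hm]
          · exact fun e => h m hm (σ.injective e).symm
          · rw [h1 m hm]
            exact fun e => h m hm ((hfg _ _).2 e.symm)
      · rw [Equiv.Perm.mul_apply, Equiv.swap_apply_def]
        split_ifs with e1 e2
        · rw [← hc, ← h2 i, e1, h2]
        · rw [h2, hc, ← e2, h2]
        · exact h2 i

theorem forward_dir {S : Type*} [Semigroup S]
    (z : S) (hz : ∀ x : S, z * x = z ∧ x * z = z) {ι : Type}
    (A : ι → Subsemigroup S) (hdec : IsZeroDirectDecomp S z A)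
    (hgreatest : ∀ (κ : Type) (B : κ → Subsemigroup S), IsZeroDirectDecomp S z B →
      ∀ i : ι, ∃ k : κ, (A i : Set S) ⊆ (B k : Set S)) (hS : Aleph0Categorical S) :
      (∀ i : ι, Aleph0Categorical (A i)) ∧
      ∃ F : Set ι, F.Finite ∧ ∀ i : ι, ∃ j ∈ F, Nonempty ((A i) ≃* (A j)) := by
  choose x hxA hxz using decomp_nonzero hdec
  constructor
  · intro i n hn
    obtain ⟨t, ht, hr⟩ := hS (n + 1) (by omega)
    choose r hrt hr using hr
    have : Finite t := ht
    obtain ⟨u, hu, hI⟩ := exists_reps (fun a : Fin n → A i =>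
      (⟨r (Fin.cons (x i) (fun k => (a k : S))), hrt _⟩ : t))
    refine ⟨u, hu, fun a => ?_⟩
    obtain ⟨b, hb, hab⟩ := hI a
    refine ⟨b, hb, ?_⟩
    have e := congrArg Subtype.val hab
    simp only at e
    have h1 := hr (Fin.cons (x i) (fun k => (b k : S)))
    rw [e] at h1
    obtain ⟨φ, hφ⟩ := h1.symm'.trans' (hr (Fin.cons (x i) (fun k => (a k : S))))
    have h0 := hφ 0
    simp only [Fin.cons_zero] at h0
    obtain ⟨ψ, hψ⟩ := block_equiv hz hdec hgreatest φ (hxz i) (hxA i) (j := i)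
      (by rw [h0]; exact hxA i)
    refine ⟨ψ, fun k => Subtype.ext ?_⟩
    have := hφ k.succ
    simp only [Fin.cons_succ] at this
    rw [hψ, this]
  · obtain ⟨t, ht, hr⟩ := hS 1 le_rfl
    choose r hrt hr using hr
    have : Finite t := ht
    obtain ⟨u, hu, hI⟩ := exists_reps (fun i : ι => (⟨r (fun _ => x i), hrt _⟩ : t))
    refine ⟨u, hu, fun i => ?_⟩
    obtain ⟨j, hj, hab⟩ := hI i
    refine ⟨j, hj, ?_⟩
    have e := congrArg Subtype.val hab
    simp only at e
    have h1 := hr (fun _ => x i)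
    rw [← e] at h1
    obtain ⟨φ, hφ⟩ := h1.symm'.trans' (hr (fun _ => x j))
    obtain ⟨ψ, -⟩ := block_equiv hz hdec hgreatest φ (hxz i) (hxA i) (j := j)
      (by rw [hφ 0]; exact hxA j)
    exact ⟨ψ⟩

theorem sigma_iso {S : Type*} [Semigroup S] {ι : Type} {A : ι → Subsemigroup S} {F : Set ι}
    {n : ℕ} {T : F → Type*} (r : ∀ j : F, (Fin n → A j) → T j)
    (hr : ∀ j u v, r j u = r j v → AutRel (A j) u v) (j j' : F) (u : Fin n → A j)
    (v : Fin n → A j') (h : (⟨j, r j u⟩ : Σ j, T j) = ⟨j', r j' v⟩) :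
    ∃ φ : A j ≃* A j', ∀ k, φ (u k) = v k := by
  have h1 : j = j' := congrArg Sigma.fst h
  subst h1
  exact hr j u v (eq_of_heq (Sigma.mk.inj h).2)

theorem backward_dir {S : Type*} [Semigroup S]
    (z : S) (hz : ∀ x : S, z * x = z ∧ x * z = z) {ι : Type}
    (A : ι → Subsemigroup S) (hdec : IsZeroDirectDecomp S z A)
    (hA : ∀ i : ι, Aleph0Categorical (A i))
    (hF : ∃ F : Set ι, F.Finite ∧ ∀ i : ι, ∃ j ∈ F, Nonempty ((A i) ≃* (A j))) :
    Aleph0Categorical S := by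
  classical
  intro n hn
  obtain ⟨F, hFf, hF⟩ := hF
  have : Finite F := hFf
  choose c0 hc0 hθ using hF
  let c : ι → F := fun i => ⟨c0 i, hc0 i⟩
  have θ : ∀ i, A i ≃* A (c i) := fun i => (hθ i).some
  choose T hT hrT using fun j : F => hA j n hn
  choose r hrt hr using hrT
  have : ∀ j, Finite (T j) := fun j => hT j
  let R : ∀ j : F, (Fin n → A j) → T j := fun j u => ⟨r j u, hrt j u⟩
  have hR : ∀ j u v, R j u = R j v → AutRel (A j) u v := by
    intro j u v h
    have e : r j u = r j v := congrArg Subtype.val h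
    have h1 := hr j u
    rw [e] at h1
    exact h1.symm'.trans' (hr j v)
  choose d hd using decomp_cover hdec
  let w : (Fin n → S) → (i : ι) → Fin n → A i := fun a i l =>
    if h : d (a l) = i then ⟨a l, h ▸ hd (a l)⟩ else ⟨z, hdec.1 i⟩
  have hw : ∀ a i l, d (a l) = i → (w a i l : S) = a l := by
    intro a i l h
    simp only [w, dif_pos h]
  obtain ⟨t, ht, hI⟩ := exists_reps (fun a : Fin n → S =>
    ((fun k l => d (a k) = d (a l), fun k =>
      ⟨c (d (a k)), R _ (fun l => θ (d (a k)) (w a (d (a k)) l))⟩) :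
      (Fin n → Fin n → Prop) × (Fin n → Σ j : F, T j)))
  refine ⟨t, ht, fun b => ?_⟩
  obtain ⟨a, hat, hab⟩ := hI b
  refine ⟨a, hat, ?_⟩
  have e1 := congrArg Prod.fst hab
  have e2 := congrArg Prod.snd hab
  simp only at e1 e2
  have hfg : ∀ k l, d (a k) = d (a l) ↔ d (b k) = d (b l) := fun k l =>
    iff_of_eq (congrFun (congrFun e1 k) l)
  have hiso : ∀ k, ∃ φ : A (d (a k)) ≃* A (d (b k)),
      ∀ l, φ (w a (d (a k)) l) = w b (d (b k)) l := by
    intro k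
    obtain ⟨φ, hφ⟩ := sigma_iso (A := A) R hR _ _ _ _ (congrFun e2 k)
    refine ⟨((θ _).trans φ).trans (θ _).symm, fun l => ?_⟩
    simp [hφ l]
  obtain ⟨σ, hσ, hσc⟩ := extend_perm c (fun k => d (a k)) (fun k => d (b k)) hfg
    (fun k => congrArg Sigma.fst (congrFun e2 k))
  have hψ : ∀ i, ∃ ψ : A i ≃* A (σ i), ∀ l, d (a l) = i → (ψ (w a i l) : S) = b l := by
    intro i
    by_cases h : ∃ k, d (a k) = i
    · obtain ⟨k, rfl⟩ := h
      rw [hσ k]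
      obtain ⟨φ, hφ⟩ := hiso k
      exact ⟨φ, fun l hl => by rw [hφ l, hw]; exact (hfg _ _).1 hl⟩
    · have e : A i ≃* A (σ i) := by
        have h1 := θ (σ i)
        rw [hσc i] at h1
        exact (θ i).trans h1.symm
      exact ⟨e, fun l hl => absurd ⟨l, hl⟩ h⟩
  choose ψ hψ using hψ
  obtain ⟨Φ, hΦ⟩ := glue hz hdec σ ψ
  refine ⟨Φ, fun k => ?_⟩
  rw [← hψ _ k rfl, ← hΦ, hw a _ k rfl]

end Aux

/-- Let `S` be a countable semigroup with zero `z` and let `{A i : i ∈ ι}` be the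
greatest 0-direct decomposition of `S`.  Then `S` is ℵ₀-categorical iff each `A i` is
ℵ₀-categorical and the family `{A i}` contains only finitely many semigroups up to
isomorphism. -/
theorem aleph0Categorical_zero_direct_union (S : Type*) [Semigroup S] [Countable S]
    (z : S) (hz : ∀ x : S, z * x = z ∧ x * z = z) {ι : Type}
    (A : ι → Subsemigroup S) (hdec : IsZeroDirectDecomp S z A)
    (hgreatest : ∀ (κ : Type) (B : κ → Subsemigroup S), IsZeroDirectDecomp S z B →
      ∀ i : ι, ∃ k : κ, (A i : Set S) ⊆ (B k : Set S)) :
    Aleph0Categorical S ↔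
      (∀ i : ι, Aleph0Categorical (A i)) ∧
      ∃ F : Set ι, F.Finite ∧ ∀ i : ι, ∃ j ∈ F, Nonempty ((A i) ≃* (A j)) := by
  exact ⟨forward_dir z hz A hdec hgreatest, fun h => backward_dir z hz A hdec h.1 h.2⟩
end
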